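/- arXiv:1209.0501 — 2 statements merged into one kernel-verified Lean document; each statement's English description precedes it below -/
import Mathlib

section
/- Let X be an infinite-dimensional Banach space with property (β) and let Y be an infinite-dimensional separable Banach space with property (M). Assume Y is the image of a uniform quotient map from a subset of X which is Lipschitz for large distances. Then there exists K ≥ 1 such that for every ε ∈ (0,1) there is a natural number n with n ≤ K·β̄_X(ε/K)^{-1} and with the n-th iterate σ_ε^{(n)}(B_Y) = ∅, where B_Y is the closed unit ball of Y. -/
open Set Metric Filter Topology

noncomputable section

/-- `T` is a uniform quotient map on `S`: uniformly continuous and co-uniformly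
continuous (with closed balls). -/
def UniformQuotientOn {X Y : Type*} [NormedAddCommGroup X] [NormedAddCommGroup Y]
    (T : X → Y) (S : Set X) : Prop :=
  (∀ ε > 0, ∃ δ > 0, ∀ x ∈ S, ∀ x' ∈ S, ‖x - x'‖ ≤ δ → ‖T x - T x'‖ ≤ ε) ∧
  (∀ ε > 0, ∃ δ > 0, ∀ x ∈ S, closedBall (T x) δ ⊆ T '' (closedBall x ε ∩ S))

/-- The set of ratios `‖Tx - Tx'‖ / ‖x - x'‖` over pairs of points of `S` at distance `≥ d`. -/
def LargeDistRatioSet {X Y : Type*} [NormedAddCommGroup X] [NormedAddCommGroup Y]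
    (T : X → Y) (S : Set X) (d : ℝ) : Set ℝ :=
  {r | ∃ x ∈ S, ∃ x' ∈ S, d ≤ ‖x - x'‖ ∧ r = ‖T x - T x'‖ / ‖x - x'‖}

/-- `L_d^T`, the Lipschitz constant of `T` for distances `≥ d`. -/
noncomputable def Ld {X Y : Type*} [NormedAddCommGroup X] [NormedAddCommGroup Y]
    (T : X → Y) (S : Set X) (d : ℝ) : ℝ :=
  sSup (LargeDistRatioSet T S d)

/-- `T` is Lipschitz for large distances: `L_d^T < ∞` for every `d > 0`. -/
def LipschitzLargeDist {X Y : Type*} [NormedAddCommGroup X] [NormedAddCommGroup Y]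
    (T : X → Y) (S : Set X) : Prop :=
  ∀ d > 0, BddAbove (LargeDistRatioSet T S d)

/-- The set of co-Lipschitz constants valid for all radii `r ≥ d`. -/
def CoLipSet {X Y : Type*} [NormedAddCommGroup X] [NormedAddCommGroup Y]
    (T : X → Y) (S : Set X) (d : ℝ) : Set ℝ :=
  {c | 0 < c ∧ ∀ r, d ≤ r → ∀ x ∈ S, ∀ y : Y, ‖y - T x‖ < c * r →
      y ∈ T '' (closedBall x r ∩ S)}

/-- `c_d^T`. -/
noncomputable def cdT {X Y : Type*} [NormedAddCommGroup X] [NormedAddCommGroup Y]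
    (T : X → Y) (S : Set X) (d : ℝ) : ℝ :=
  sSup (CoLipSet T S d)

/-- `C^T = lim_{d → ∞} c_d^T` (the limit of the nondecreasing family `c_d^T`,
i.e. its supremum). -/
noncomputable def CT {X Y : Type*} [NormedAddCommGroup X] [NormedAddCommGroup Y]
    (T : X → Y) (S : Set X) : ℝ :=
  sSup {c | ∃ d, 0 < d ∧ c = cdT T S d}

/-- The set of admissible `δ`'s in the definition of the modulus `β̄_X(t)`. -/
def betaModSet (X : Type*) [NormedAddCommGroup X] (t : ℝ) : Set ℝ :=
  {δ | 0 ≤ δ ∧ ∀ x ∈ closedBall (0 : X) 1, ∀ xs : ℕ → X,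
      (∀ n, xs n ∈ closedBall (0 : X) 1) →
      (∀ m n, m ≠ n → t ≤ ‖xs m - xs n‖) →
      ∃ n, ‖x - xs n‖ / 2 ≤ 1 - δ}

/-- The modulus `β̄_X(t)` of property (β) of Rolewicz. -/
noncomputable def betaMod (X : Type*) [NormedAddCommGroup X] (t : ℝ) : ℝ :=
  sSup (betaModSet X t)

/-- Property (β) of Rolewicz. -/
def PropertyBeta (X : Type*) [NormedAddCommGroup X] : Prop :=
  ∃ a, 1 ≤ a ∧ a ≤ 2 ∧ ∀ t, 0 < t → t ≤ a → ∃ δ, 0 < δ ∧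
    ∀ x ∈ closedBall (0 : X) 1, ∀ xs : ℕ → X,
      (∀ n, xs n ∈ closedBall (0 : X) 1) →
      (∀ m n, m ≠ n → t ≤ ‖xs m - xs n‖) →
      ∃ n, ‖x - xs n‖ / 2 ≤ 1 - δ

/-- `Z` is a closed subspace of finite codimension. -/
def FinCodim {Y : Type*} [NormedAddCommGroup Y] [NormedSpace ℝ Y] (Z : Subspace ℝ Y) : Prop :=
  IsClosed (Z : Set Y) ∧ FiniteDimensional ℝ (Y ⧸ Z)

/-- `ρ̄_Y(t, y) = inf_Z sup_{z ∈ S_Z} (‖y + tz‖ - 1)`. -/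
noncomputable def rhoAt {Y : Type*} [NormedAddCommGroup Y] [NormedSpace ℝ Y]
    (t : ℝ) (y : Y) : ℝ :=
  sInf {s | ∃ Z : Subspace ℝ Y, FinCodim Z ∧
    s = sSup {r | ∃ z ∈ Z, ‖z‖ = 1 ∧ r = ‖y + t • z‖ - 1}}

/-- The modulus of asymptotic uniform smoothness `ρ̄_Y(t)`. -/
noncomputable def rhoMod (Y : Type*) [NormedAddCommGroup Y] [NormedSpace ℝ Y] (t : ℝ) : ℝ :=
  sSup {r | ∃ y : Y, ‖y‖ = 1 ∧ r = rhoAt t y}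

/-- `δ̄_Y(t, y) = sup_Z inf_{z ∈ S_Z} (‖y + tz‖ - 1)`. -/
noncomputable def deltaAt {Y : Type*} [NormedAddCommGroup Y] [NormedSpace ℝ Y]
    (t : ℝ) (y : Y) : ℝ :=
  sSup {s | ∃ Z : Subspace ℝ Y, FinCodim Z ∧
    s = sInf {r | ∃ z ∈ Z, ‖z‖ = 1 ∧ r = ‖y + t • z‖ - 1}}

/-- The modulus of asymptotic uniform convexity `δ̄_Y(t)`. -/
noncomputable def deltaMod (Y : Type*) [NormedAddCommGroup Y] [NormedSpace ℝ Y] (t : ℝ) : ℝ :=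
  sInf {r | ∃ y : Y, ‖y‖ = 1 ∧ r = deltaAt t y}

/-- The norm of `Y` is asymptotically uniformly smooth. -/
def AUS (Y : Type*) [NormedAddCommGroup Y] [NormedSpace ℝ Y] : Prop :=
  Tendsto (fun t => rhoMod Y t / t) (𝓝[>] 0) (𝓝 0)

/-- The norm of `Y` is asymptotically uniformly convex. -/
def AUC (Y : Type*) [NormedAddCommGroup Y] [NormedSpace ℝ Y] : Prop :=
  ∀ t > 0, 0 < deltaMod Y t

/-- A sequence is basic with basis constant at most `K`. -/
def IsBasicWithConst {Y : Type*} [NormedAddCommGroup Y] [NormedSpace ℝ Y]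
    (K : ℝ) (e : ℕ → Y) : Prop :=
  ∀ (a : ℕ → ℝ) (m n : ℕ), m ≤ n →
    ‖∑ i ∈ Finset.range m, a i • e i‖ ≤ K * ‖∑ i ∈ Finset.range n, a i • e i‖

/-- A weakly null sequence. -/
def WeaklyNull {Y : Type*} [NormedAddCommGroup Y] [NormedSpace ℝ Y] (xs : ℕ → Y) : Prop :=
  ∀ f : Y →L[ℝ] ℝ, Tendsto (fun n => f (xs n)) atTop (𝓝 0)

/-- Property (M) of Kalton. -/
def PropertyM (Y : Type*) [NormedAddCommGroup Y] [NormedSpace ℝ Y] : Prop :=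
  ∀ u v : Y, ‖u‖ = 1 → ‖v‖ = 1 → ∀ xs : ℕ → Y, WeaklyNull xs →
    limsup (fun n => ‖u + xs n‖) atTop = limsup (fun n => ‖v + xs n‖) atTop

/-- `N` is a norm on `X` equivalent to the given one. -/
def IsEquivNorm {X : Type*} [NormedAddCommGroup X] [NormedSpace ℝ X] (N : X → ℝ) : Prop :=
  (∀ x y, N (x + y) ≤ N x + N y) ∧
  (∀ (a : ℝ) (x : X), N (a • x) = |a| * N x) ∧
  (∃ c > 0, ∃ C > 0, ∀ x : X, c * ‖x‖ ≤ N x ∧ N x ≤ C * ‖x‖)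

/-- The norm `N` has property (β) of Rolewicz. -/
def NormHasPropertyBeta {X : Type*} [NormedAddCommGroup X] (N : X → ℝ) : Prop :=
  ∃ a, 1 ≤ a ∧ a ≤ 2 ∧ ∀ t, 0 < t → t ≤ a → ∃ δ, 0 < δ ∧
    ∀ x : X, N x ≤ 1 → ∀ xs : ℕ → X, (∀ n, N (xs n) ≤ 1) →
      (∀ m n, m ≠ n → t ≤ N (xs m - xs n)) →
      ∃ n, N (x - xs n) / 2 ≤ 1 - δ

/-- `U` is weakly open in `Y`: every point has a basic weak neighborhood
(finitely many functionals) inside `U`. -/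
def WeaklyOpen {Y : Type*} [NormedAddCommGroup Y] [NormedSpace ℝ Y] (U : Set Y) : Prop :=
  ∀ y ∈ U, ∃ (k : ℕ) (f : Fin k → (Y →L[ℝ] ℝ)) (δ : ℝ), 0 < δ ∧
    {z : Y | ∀ i, |f i z - f i y| < δ} ⊆ U

/-- The "Szlenk type" derivation `σ'_ε`: remove from `F` the union of all relatively
weakly open subsets of `F` of norm-diameter at most `ε`. -/
def sigmaPrime {Y : Type*} [NormedAddCommGroup Y] [NormedSpace ℝ Y]
    (ε : ℝ) (F : Set Y) : Set Y :=
  F \ ⋃₀ {V : Set Y | (∃ U : Set Y, WeaklyOpen U ∧ V = U ∩ F) ∧ Metric.diam V ≤ ε}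


lemma aux_lip {X Y : Type*} [NormedAddCommGroup X] [NormedAddCommGroup Y]
    (S : Set X) (T : X → Y) (hT : UniformQuotientOn T S) (hLip : LipschitzLargeDist T S) :
    ∃ L : ℝ, 1 ≤ L ∧ ∀ x ∈ S, ∀ x' ∈ S, 1 < ‖T x - T x'‖ → ‖T x - T x'‖ ≤ L * ‖x - x'‖ := by
  obtain ⟨δ, hδ, h⟩ := hT.1 1 one_pos
  obtain ⟨L, hL⟩ := hLip δ hδ
  refine ⟨max L 1, le_max_right _ _, fun x hx x' hx' h1 => ?_⟩
  have hd : δ < ‖x - x'‖ := by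
    by_contra hcon
    have := h x hx x' hx' (not_lt.1 hcon)
    linarith
  have h2 : ‖T x - T x'‖ / ‖x - x'‖ ≤ L := hL ⟨x, hx, x', hx', hd.le, rfl⟩
  have hp : 0 < ‖x - x'‖ := hδ.trans hd
  rw [div_le_iff₀ hp] at h2
  exact h2.trans (mul_le_mul_of_nonneg_right (le_max_left _ _) hp.le)

lemma aux_chain {X Y : Type*} [NormedAddCommGroup X] [NormedAddCommGroup Y] [NormedSpace ℝ Y]
    (S : Set X) (T : X → Y) (δ : ℝ)
    (h : ∀ x ∈ S, closedBall (T x) δ ⊆ T '' (closedBall x 1 ∩ S)) (n : ℕ) :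
    ∀ x ∈ S, ∀ y, ‖y - T x‖ ≤ (n + 1 : ℕ) * δ → ∃ x' ∈ S, ‖x' - x‖ ≤ (n + 1 : ℕ) ∧ T x' = y := by
  induction n with
  | zero =>
    intro x hx y hy
    obtain ⟨x', ⟨h1, h2⟩, h3⟩ := h x hx (show y ∈ closedBall (T x) δ by
      simpa [mem_closedBall, dist_eq_norm] using hy)
    exact ⟨x', h2, by simpa [mem_closedBall, dist_eq_norm] using h1, h3⟩
  | succ n ih =>
    intro x hx y hy
    push_cast at hy
    set N : ℝ := (n : ℝ) + 1 + 1 with hN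
    have hNp : 0 < N := by positivity
    set m : Y := T x + (1 - 1 / N) • (y - T x) with hm
    have e1 : m - T x = (1 - 1 / N) • (y - T x) := by rw [hm]; abel
    have e2 : y - m = (1 / N) • (y - T x) := by rw [hm]; module
    have hN1 : 1 / N ≤ 1 := by
      rw [div_le_one hNp]; linarith [Nat.cast_nonneg (α := ℝ) n]
    obtain ⟨x₁, hx₁, h₁, h₁'⟩ := ih x hx m (by
      rw [e1, norm_smul, Real.norm_of_nonneg (by linarith)]
      calc (1 - 1 / N) * ‖y - T x‖ ≤ (1 - 1 / N) * (N * δ) :=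
            mul_le_mul_of_nonneg_left hy (by linarith)
        _ = ((n + 1 : ℕ) : ℝ) * δ := by field_simp; rw [hN]; push_cast; ring)
    obtain ⟨x', ⟨h1, h2⟩, h3⟩ := h x₁ hx₁ (show y ∈ closedBall (T x₁) δ by
      rw [mem_closedBall, dist_eq_norm, h₁', e2, norm_smul, Real.norm_of_nonneg (by positivity)]
      rw [div_mul_eq_mul_div, one_mul, div_le_iff₀ hNp]; linarith)
    refine ⟨x', h2, ?_, h3⟩
    rw [mem_closedBall, dist_eq_norm] at h1
    have := norm_sub_le_norm_sub_add_norm_sub x' x₁ x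
    push_cast at h₁ ⊢
    linarith

/-- co-Lipschitz with constant c at distances at least d -/
def CoL {X Y : Type*} [NormedAddCommGroup X] [NormedAddCommGroup Y]
    (T : X → Y) (S : Set X) (c d : ℝ) : Prop :=
  ∀ r, d ≤ r → ∀ x ∈ S, ∀ y : Y, ‖y - T x‖ ≤ c * r → ∃ x' ∈ S, ‖x' - x‖ ≤ r ∧ T x' = y

lemma aux_colip {X Y : Type*} [NormedAddCommGroup X] [NormedAddCommGroup Y] [NormedSpace ℝ Y]
    (S : Set X) (T : X → Y) (hT : UniformQuotientOn T S) :
    ∃ c : ℝ, 0 < c ∧ CoL T S c 1 := by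
  obtain ⟨δ, hδ, h⟩ := hT.2 1 one_pos
  refine ⟨δ / 2, by positivity, fun r hr x hx y hy => ?_⟩
  have hf : 1 ≤ ⌊r⌋₊ := (Nat.one_le_floor_iff r).2 hr
  obtain ⟨n, hn⟩ : ∃ n, ⌊r⌋₊ = n + 1 := ⟨⌊r⌋₊ - 1, by omega⟩
  have h1 : ((n + 1 : ℕ) : ℝ) ≤ r := by rw [← hn]; exact Nat.floor_le (by linarith)
  have h2 : r < ((n + 1 : ℕ) : ℝ) + 1 := by rw [← hn]; exact Nat.lt_floor_add_one r
  have h3 : (1 : ℝ) ≤ ((n + 1 : ℕ) : ℝ) := by push_cast; linarith [Nat.cast_nonneg (α := ℝ) n]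
  obtain ⟨x', a, b, c⟩ := aux_chain S T δ h n x hx y (by nlinarith)
  exact ⟨x', a, b.trans h1, c⟩

/-- the beta condition, scaled -/
lemma aux_beta {X : Type*} [NormedAddCommGroup X] [NormedSpace ℝ X] {t b : ℝ}
    (hb : b ∈ betaModSet X t) (m x : X) (z : ℕ → X) (r : ℝ) (hr : 0 < r)
    (hx : ‖x - m‖ ≤ r) (hz : ∀ n, ‖z n - m‖ ≤ r)
    (hs : ∀ i j, i ≠ j → t * r ≤ ‖z i - z j‖) : ∃ n, ‖z n - x‖ ≤ 2 * r * (1 - b) := by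
  have key : ∀ v : X, ‖r⁻¹ • v‖ = ‖v‖ / r := fun v => by
    rw [norm_smul, norm_inv, Real.norm_of_nonneg hr.le]; field_simp
  obtain ⟨n, hn⟩ := hb.2 (r⁻¹ • (x - m))
    (by rw [mem_closedBall_zero_iff, key, div_le_one hr]; exact hx)
    (fun n => r⁻¹ • (z n - m))
    (fun n => by rw [mem_closedBall_zero_iff, key, div_le_one hr]; exact hz n)
    (fun i j hij => by
      rw [← smul_sub, key, le_div_iff₀ hr, sub_sub_sub_cancel_right]; exact hs i j hij)
  refine ⟨n, ?_⟩
  rw [← smul_sub, key, sub_sub_sub_cancel_right, norm_sub_rev, div_div, div_le_iff₀ (by positivity)] at hn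
  linarith

set_option maxHeartbeats 1000000 in
lemma aux_fork {X Y : Type*} [NormedAddCommGroup X] [NormedSpace ℝ X]
    [NormedAddCommGroup Y] [NormedSpace ℝ Y] [Nontrivial Y]
    (S : Set X) (T : X → Y) (hsurj : T '' S = Set.univ) (L c₀ : ℝ) (hL1 : 1 ≤ L)
    (hL : ∀ x ∈ S, ∀ x' ∈ S, 1 < ‖T x - T x'‖ → ‖T x - T x'‖ ≤ L * ‖x - x'‖)
    (hc₀ : 0 < c₀) (hc : CoL T S c₀ 1)
    (t b s φ : ℝ) (hs : 0 < s) (hb : b ∈ betaModSet X t) (hb1 : b ≤ 1)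
    (ht : t ≤ c₀ * s / (8 * L)) (hφ1 : 1 ≤ φ) (hφ3 : φ ≤ 3)
    (w : ℕ → Y) (hw : ∀ v : Y, ‖v‖ = 1 → ∀ η > 0, ∀ᶠ n in atTop, ‖v + w n‖ ≤ φ + η)
    (hsep : ∀ i j, i ≠ j → s ≤ ‖w i - w j‖) :
    1 ≤ φ * (1 - 2 * b / 3) := by
  by_contra hcon
  push Not at hcon
  have hLp : 0 < L := by linarith
  -- the set of co-Lipschitz constants
  set A : Set ℝ := {c | ∃ d, 0 < d ∧ CoL T S c d} with hA
  have hAc : c₀ ∈ A := ⟨1, one_pos, hc⟩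
  obtain ⟨e, he⟩ := exists_norm_eq Y (zero_le_one' ℝ)
  obtain ⟨x₀, hx₀, -⟩ : (0 : Y) ∈ T '' S := by rw [hsurj]; trivial
  have hbdd : ∀ c ∈ A, c ≤ L := by
    rintro c ⟨d, hd, h⟩
    by_contra hcl
    push Not at hcl
    have hcp : 0 < c := hLp.trans hcl
    set r := max d (2 / c) with hr
    have hrd : d ≤ r := le_max_left _ _
    have hr2 : 2 ≤ c * r := by
      have : 2 / c ≤ r := le_max_right _ _
      rw [div_le_iff₀ hcp] at this; linarith
    have hrp : 0 < r := hd.trans_le hrd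
    obtain ⟨x', hx', h1, h2⟩ := h r hrd x₀ hx₀ (T x₀ + (c * r) • e) (by
      rw [add_sub_cancel_left, norm_smul, he, Real.norm_of_nonneg (by positivity), mul_one])
    have h3 : ‖T x' - T x₀‖ = c * r := by
      rw [h2, add_sub_cancel_left, norm_smul, he, Real.norm_of_nonneg (by positivity), mul_one]
    have := hL x' hx' x₀ hx₀ (by rw [h3]; linarith)
    rw [h3] at this
    nlinarith
  have hbA : BddAbove A := ⟨L, hbdd⟩
  set C := sSup A with hC
  have hcC : c₀ ≤ C := le_csSup hbA hAc
  have hCp : 0 < C := hc₀.trans_le hcC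
  obtain ⟨φ', hφ', hφ4, hq⟩ : ∃ φ', φ < φ' ∧ φ' ≤ 4 ∧ φ' * (1 - 2 * b / 3) < 1 := by
    have h0 : 0 < 1 - 2 * b / 3 := by linarith
    rw [← lt_div_iff₀ h0] at hcon
    obtain ⟨p, hp1, hp2⟩ := exists_between (lt_min hcon (show φ < 4 by linarith))
    refine ⟨p, hp1, (hp2.trans_le (min_le_right _ _)).le, ?_⟩
    rw [← lt_div_iff₀ h0]
    exact hp2.trans_le (min_le_left _ _)
  set q := φ' * (1 - 2 * b / 3) with hqd
  have hq0 : 0 < q := by apply mul_pos <;> linarith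
  obtain ⟨a, ha1, ha2⟩ := exists_between (max_lt (mul_lt_of_lt_one_left hCp hq) (half_lt_self hCp))
  have haq : q * C < a := (le_max_left _ _).trans_lt ha1
  have hah : C / 2 < a := (le_max_right _ _).trans_lt ha1
  have hap : 0 < a := by linarith
  obtain ⟨c, ⟨d, hd, hcd⟩, hac⟩ := exists_lt_of_lt_csSup ⟨_, hAc⟩ ha2
  have hcp : 0 < c := by linarith
  have hcq : q * C < c := by linarith
  obtain ⟨c', hc1, hc2⟩ := exists_between (show C < c / q by rw [lt_div_iff₀ hq0]; linarith)
  have hc'q : c' * q < c := by rwa [lt_div_iff₀ hq0] at hc2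
  set D := max (3 * d) (6 / (c * s)) with hD
  have hDp : 0 < D := lt_max_of_lt_left (by positivity)
  have hnot : ¬ CoL T S c' D := fun h => by
    have := le_csSup hbA (show c' ∈ A from ⟨D, hDp, h⟩)
    linarith
  unfold CoL at hnot
  push Not at hnot
  obtain ⟨r, hr, x, hx, y₀, hy₀, hno⟩ := hnot
  have hrp : 0 < r := hDp.trans_le hr
  have hr3 : 3 * d ≤ r := (le_max_left _ _).trans hr
  have hr6 : 6 ≤ c * s * r := by
    have := (le_max_right (3 * d) (6 / (c * s))).trans hr
    rw [div_le_iff₀ (by positivity)] at this; linarith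
  set R := ‖y₀ - T x‖ with hR
  have hRr : c * r < R := by
    by_contra hcon2
    obtain ⟨x', h1, h2, h3⟩ := hcd r (by linarith) x hx y₀ (not_lt.1 hcon2)
    exact hno x' h1 h2 h3
  have hRp : 0 < R := lt_trans (by positivity) hRr
  set u : Y := R⁻¹ • (y₀ - T x) with hu
  have hun : ‖u‖ = 1 := by
    rw [hu, norm_smul, norm_inv, Real.norm_of_nonneg hRp.le, ← hR, inv_mul_cancel₀ hRp.ne']
  have hyu : y₀ = T x + R • u := by
    rw [hu, smul_smul, mul_inv_cancel₀ hRp.ne', one_smul]; abel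
  set m : Y := T x + (R / 3) • u with hm
  set r₂ := R * φ' / (3 * c) with hr2
  have hφ'1 : 1 < φ' := by linarith
  have hcr2 : c * r₂ = R / 3 * φ' := by rw [hr2]; field_simp
  have hr2p : 0 < r₂ := by rw [hr2]; positivity
  have hdr2 : d ≤ r₂ := by
    rw [hr2, le_div_iff₀ (by positivity)]
    nlinarith
  obtain ⟨xm, hxm, hxm1, hxm2⟩ := hcd r₂ hdr2 x hx m (by
    rw [hm, add_sub_cancel_left, norm_smul, hun, Real.norm_of_nonneg (by positivity), hcr2]
    nlinarith)
  obtain ⟨N, hN⟩ := eventually_atTop.1 ((hw u hun (φ' - φ) (by linarith)).and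
    (hw (-u) (by rw [norm_neg, hun]) (φ' - φ) (by linarith)))
  have hz : ∀ n, ∃ z ∈ S, ‖z - xm‖ ≤ r₂ ∧ T z = m + (R / 3) • (u + w (N + n)) := fun n => by
    refine hcd r₂ hdr2 xm hxm _ ?_
    rw [hxm2, add_sub_cancel_left, norm_smul, Real.norm_of_nonneg (by positivity), hcr2]
    have := (hN (N + n) (by omega)).1
    exact mul_le_mul_of_nonneg_left (by linarith) (by positivity)
  choose z hzS hz1 hz2 using hz
  obtain ⟨n, hn⟩ := aux_beta hb xm x z r₂ hr2p (by rwa [norm_sub_rev]) hz1 (fun i j hij => by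
    have h1 : ‖T (z i) - T (z j)‖ = R / 3 * ‖w (N + i) - w (N + j)‖ := by
      rw [hz2, hz2, add_sub_add_left_eq_sub, ← smul_sub, add_sub_add_left_eq_sub, norm_smul,
        Real.norm_of_nonneg (by positivity)]
    have h2 : R / 3 * s ≤ ‖T (z i) - T (z j)‖ := by
      rw [h1]
      exact mul_le_mul_of_nonneg_left (hsep _ _ (by omega)) (by positivity)
    have h3 := hL (z i) (hzS i) (z j) (hzS j) (by
      have h0 : c * r * s < R * s := mul_lt_mul_of_pos_right hRr hs
      linarith)
    have h4 : t * r₂ ≤ c₀ * s / (8 * L) * r₂ := mul_le_mul_of_nonneg_right ht hr2p.le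
    have h5 : c₀ * s / (8 * L) * r₂ * L = c₀ * s * r₂ / 8 := by field_simp
    have h6 : c₀ * s * r₂ / 8 ≤ R / 3 * s := by
      have h7 : c₀ * r₂ ≤ 2 * c * r₂ := mul_le_mul_of_nonneg_right (by linarith) hr2p.le
      have h70 : R / 3 * φ' ≤ R / 3 * 4 := mul_le_mul_of_nonneg_left hφ4 (by positivity)
      have h8 : c₀ * r₂ ≤ 8 * (R / 3) := by linarith
      have h80 := mul_le_mul_of_nonneg_right h8 hs.le
      linarith
    have h9 : c₀ * s / (8 * L) * r₂ * L ≤ ‖z i - z j‖ * L := by rw [h5]; linarith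
    exact h4.trans (le_of_mul_le_mul_right h9 hLp))
  obtain ⟨z', hz'S, hz'1, hz'2⟩ := hcd r₂ hdr2 (z n) (hzS n) y₀ (by
    have e1 : y₀ - T (z n) = -((R / 3) • (-u + w (N + n))) := by
      rw [hz2, hm, hyu]; module
    rw [e1, norm_neg, norm_smul, Real.norm_of_nonneg (by positivity), hcr2]
    have := (hN (N + n) (by omega)).2
    exact mul_le_mul_of_nonneg_left (by linarith) (by positivity))
  refine hno z' hz'S ?_ hz'2
  have h1 := norm_sub_le_norm_sub_add_norm_sub z' (z n) x
  have h2 : r₂ + 2 * r₂ * (1 - b) = R * q / c := by rw [hr2, hqd]; field_simp; ring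
  have h3 : R * q / c ≤ r := by
    rw [div_le_iff₀ hcp]
    nlinarith
  linarith

lemma aux_E {Y : Type*} [NormedAddCommGroup Y] [NormedSpace ℝ Y]
    [TopologicalSpace.SeparableSpace Y]
    (hns : ¬ TopologicalSpace.SeparableSpace (Y →L[ℝ] ℝ)) :
    ∃ M : ℝ, 1 ≤ M ∧ ∃ ε : ℝ, 0 < ε ∧ ∃ E : Set (Y →L[ℝ] ℝ), E.Nonempty ∧ (∀ f ∈ E, ‖f‖ ≤ M) ∧
      ∀ f ∈ E, ∀ F : Finset Y, ∀ δ > 0, ∀ D : Set (Y →L[ℝ] ℝ), D.Countable →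
        ∃ g ∈ E, (∀ y ∈ F, |g y - f y| ≤ δ) ∧ ∀ h ∈ D, ε ≤ ‖g - h‖ := by
  obtain ⟨n, ε, hε, hnc⟩ : ∃ n : ℕ, ∃ ε : ℝ, 0 < ε ∧ ¬ ∃ D : Set (Y →L[ℝ] ℝ), D.Countable ∧
      ∀ g : Y →L[ℝ] ℝ, ‖g‖ ≤ n → ∃ h ∈ D, ‖g - h‖ < ε := by
    by_contra hcon
    push Not at hcon
    have h1 : ∀ n m : ℕ, ∃ D : Set (Y →L[ℝ] ℝ), D.Countable ∧
      ∀ g : Y →L[ℝ] ℝ, ‖g‖ ≤ n → ∃ h ∈ D, ‖g - h‖ < 1 / ((m : ℝ) + 1) :=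
      fun n m => hcon n _ (by positivity)
    choose D hD1 hD2 using h1
    refine hns ⟨⟨⋃ n, ⋃ m, D n m, countable_iUnion fun n => countable_iUnion fun m => hD1 n m, ?_⟩⟩
    rw [Metric.dense_iff]
    intro g r hr
    obtain ⟨n, hn⟩ := exists_nat_ge ‖g‖
    obtain ⟨m, hm⟩ := exists_nat_one_div_lt hr
    obtain ⟨h, hh1, hh2⟩ := hD2 n m g hn
    refine ⟨h, ?_, mem_iUnion.2 ⟨n, mem_iUnion.2 ⟨m, hh1⟩⟩⟩
    rw [mem_ball, dist_comm, dist_eq_norm]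
    exact hh2.trans hm
  set d : ℕ → Y := TopologicalSpace.denseSeq Y with hd
  set Φ : (Y →L[ℝ] ℝ) → (ℕ → ℝ) := fun f i => f (d i) with hΦ
  set cov : Set (ℕ → ℝ) → Prop := fun V => ∃ D : Set (Y →L[ℝ] ℝ), D.Countable ∧
      ∀ g : Y →L[ℝ] ℝ, ‖g‖ ≤ n → Φ g ∈ V → ∃ h ∈ D, ‖g - h‖ < ε with hcov
  obtain ⟨𝒯, h𝒯c, h𝒯s, h𝒯u⟩ := TopologicalSpace.isOpen_sUnion_countable
    {V : Set (ℕ → ℝ) | IsOpen V ∧ cov V} (fun V hV => hV.1)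
  have hW : cov (⋃₀ 𝒯) := by
    have h1 : ∀ V : 𝒯, cov V := fun V => (h𝒯s V.2).2
    choose D hD1 hD2 using h1
    have := h𝒯c.to_subtype
    refine ⟨⋃ V, D V, countable_iUnion hD1, fun g hg hgV => ?_⟩
    obtain ⟨V, hV, hgV⟩ := hgV
    obtain ⟨h, hh, hh'⟩ := hD2 ⟨V, hV⟩ g hg hgV
    exact ⟨h, mem_iUnion.2 ⟨_, hh⟩, hh'⟩
  set E : Set (Y →L[ℝ] ℝ) := {f | ‖f‖ ≤ n ∧ Φ f ∉ ⋃₀ 𝒯} with hE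
  refine ⟨max n 1, le_max_right _ _, ε, hε, E, ?_, fun f hf => hf.1.trans (le_max_left _ _), ?_⟩
  · by_contra hne
    rw [Set.not_nonempty_iff_eq_empty] at hne
    obtain ⟨D, hD1, hD2⟩ := hW
    refine hnc ⟨D, hD1, fun g hg => hD2 g hg ?_⟩
    by_contra hh
    have : g ∈ E := ⟨hg, hh⟩
    rw [hne] at this
    exact this
  · intro f hf F δ hδ D hD
    by_contra hcon
    push Not at hcon
    have hη : 0 < δ / (4 * ((n : ℝ) + 1)) := by positivity
    have hi : ∀ y : Y, ∃ i, dist y (d i) < δ / (4 * ((n : ℝ) + 1)) := fun y =>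
      (TopologicalSpace.denseRange_denseSeq Y).exists_dist_lt y hη
    choose i hi using hi
    set V : Set (ℕ → ℝ) := ⋂ y ∈ F, {p | |p (i y) - f (d (i y))| < δ / 2} with hV
    have hVo : IsOpen V := by
      refine isOpen_biInter_finset fun y _ => ?_
      exact isOpen_lt (by fun_prop) continuous_const
    have hfV : Φ f ∈ V := by
      simp only [hV, mem_iInter, mem_ofPred_eq, hΦ, sub_self, abs_zero]
      intro y _; positivity
    have hcV : cov V := by
      obtain ⟨D', hD'1, hD'2⟩ := hW
      refine ⟨D ∪ D', hD.union hD'1, fun g hg hgV => ?_⟩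
      by_cases hgW : Φ g ∈ ⋃₀ 𝒯
      · obtain ⟨h, hh, hh'⟩ := hD'2 g hg hgW
        exact ⟨h, Or.inr hh, hh'⟩
      · obtain ⟨h, hh, hh'⟩ := hcon g ⟨hg, hgW⟩ (fun y hy => by
          have h1 : |g (d (i y)) - f (d (i y))| < δ / 2 := by
            simp only [hV, mem_iInter] at hgV
            exact hgV y hy
          have h2 : g y - f y = (g - f) (y - d (i y)) + (g (d (i y)) - f (d (i y))) := by
            simp only [map_sub, ContinuousLinearMap.sub_apply]; ring
          have h3 : |(g - f) (y - d (i y))| ≤ δ / 2 := by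
            have h4 := (g - f).le_opNorm (y - d (i y))
            have h5 : ‖g - f‖ ≤ 2 * n := by
              have := norm_sub_le g f
              linarith [hf.1]
            have h6 := hi y
            rw [dist_eq_norm] at h6
            rw [Real.norm_eq_abs] at h4
            calc _ ≤ ‖g - f‖ * ‖y - d (i y)‖ := h4
              _ ≤ (2 * ((n : ℝ) + 1)) * (δ / (4 * ((n : ℝ) + 1))) := by
                  apply mul_le_mul _ h6.le (norm_nonneg _) (by positivity)
                  linarith
              _ = δ / 2 := by field_simp; norm_num
          rw [h2]
          exact (abs_add_le _ _).trans (by linarith))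
        exact ⟨h, Or.inl hh, hh'⟩
    apply hf.2
    rw [h𝒯u]
    exact ⟨V, ⟨hVo, hcV⟩, hfV⟩

lemma aux_ann {Y : Type*} [NormedAddCommGroup Y] [NormedSpace ℝ Y]
    (G : Finset (Y →L[ℝ] ℝ)) (g : Y →L[ℝ] ℝ) (ε : ℝ) (hε : 0 < ε)
    (hg : ∀ h ∈ Submodule.span ℝ (G : Set (Y →L[ℝ] ℝ)), ε ≤ ‖g - h‖) :
    ∃ z : Y, ‖z‖ ≤ 1 ∧ (∀ h ∈ G, h z = 0) ∧ ε / 2 ≤ g z := by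
  by_contra hcon
  push Not at hcon
  set N : Submodule ℝ Y := ⨅ h : G, LinearMap.ker ((h : Y →L[ℝ] ℝ) : Y →ₗ[ℝ] ℝ) with hN
  have hmem : ∀ z ∈ N, ∀ h ∈ G, h z = 0 := fun z hz h hh => by
    rw [hN, Submodule.mem_iInf] at hz
    exact hz ⟨h, hh⟩
  set gN : N →L[ℝ] ℝ := g.comp N.subtypeL with hgN
  have hle : ‖gN‖ ≤ ε / 2 := by
    refine gN.opNorm_le_of_unit_norm (by positivity) fun z hz => ?_
    have h1 := hcon z (by simpa using hz.le) (hmem z z.2)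
    have h2 := hcon (-z : N) (by simpa using hz.le) (hmem _ (-z : N).2)
    simp only [Submodule.coe_neg, map_neg] at h2
    rw [Real.norm_eq_abs, abs_le]
    simp only [hgN, ContinuousLinearMap.comp_apply, Submodule.subtypeL_apply]
    constructor <;> linarith
  obtain ⟨g', hg'1, hg'2⟩ := exists_extension_norm_eq N gN
  have hspan : ((g - g' : Y →L[ℝ] ℝ) : Y →ₗ[ℝ] ℝ) ∈
      Submodule.span ℝ (Set.range fun h : G => ((h : Y →L[ℝ] ℝ) : Y →ₗ[ℝ] ℝ)) := by
    apply mem_span_of_iInf_ker_le_ker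
    intro z hz
    have := hg'1 ⟨z, hz⟩
    simp only [hgN, ContinuousLinearMap.comp_apply, Submodule.subtypeL_apply] at this
    simp [this]
  have hspan2 : g - g' ∈ Submodule.span ℝ (G : Set (Y →L[ℝ] ℝ)) := by
    rw [Submodule.mem_span_range_iff_exists_fun] at hspan
    obtain ⟨a, ha⟩ := hspan
    have : g - g' = ∑ h : G, a h • (h : Y →L[ℝ] ℝ) := by
      ext z
      have := LinearMap.congr_fun ha z
      simp at this
      simp [← this, ContinuousLinearMap.sum_apply]
    rw [this]
    exact Submodule.sum_mem _ fun h _ => Submodule.smul_mem _ _ (Submodule.subset_span h.2)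
  have := hg _ hspan2
  rw [sub_sub_cancel] at this
  linarith

lemma aux_E2 {Y : Type*} [NormedAddCommGroup Y] [NormedSpace ℝ Y] {E : Set (Y →L[ℝ] ℝ)} {ε : ℝ}
    (hε : 0 < ε)
    (hE : ∀ f ∈ E, ∀ F : Finset Y, ∀ δ > 0, ∀ D : Set (Y →L[ℝ] ℝ), D.Countable →
        ∃ g ∈ E, (∀ y ∈ F, |g y - f y| ≤ δ) ∧ ∀ h ∈ D, ε ≤ ‖g - h‖) :
    ∀ f ∈ E, ∀ F : Finset Y, ∀ δ > 0, ∀ G : Finset (Y →L[ℝ] ℝ),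
        ∃ g ∈ E, (∀ y ∈ F, |g y - f y| ≤ δ) ∧
          ∃ z : Y, ‖z‖ ≤ 1 ∧ (∀ h ∈ G, h z = 0) ∧ ε / 2 ≤ g z := by
  intro f hf F δ hδ G
  obtain ⟨D, hD1, hD2⟩ := (TopologicalSpace.IsSeparable.span (R := ℝ)
    (G.countable_toSet.isSeparable))
  obtain ⟨g, hg, hgF, hgD⟩ := hE f hf F δ hδ D hD1
  refine ⟨g, hg, hgF, aux_ann G g ε hε fun h hh => ?_⟩
  have hcl : IsClosed {h : Y →L[ℝ] ℝ | ε ≤ ‖g - h‖} :=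
    isClosed_le continuous_const (by fun_prop)
  exact closure_minimal (fun h hh => hgD h hh) hcl (hD2 hh)

lemma aux_claim {X Y : Type*} [NormedAddCommGroup X] [NormedSpace ℝ X]
    [NormedAddCommGroup Y] [NormedSpace ℝ Y]
    (S : Set X) (T : X → Y) (L r₀ M b : ℝ) (hL1 : 1 ≤ L)
    (hL : ∀ x ∈ S, ∀ x' ∈ S, 1 < ‖T x - T x'‖ → ‖T x - T x'‖ ≤ L * ‖x - x'‖)
    (hr₀ : 0 < r₀) (hM : 1 ≤ M) (hb : b ∈ betaModSet X (1 / (L * r₀))) (hb1 : b < 1)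
    (E : Set (Y →L[ℝ] ℝ)) (hEM : ∀ f ∈ E, ‖f‖ ≤ M)
    (h0 : ∀ x ∈ S, ∀ f ∈ E, ∀ F : Finset Y, ∀ δ > 0, ∀ G : Finset (Y →L[ℝ] ℝ),
      ∃ x' ∈ S, ∃ g ∈ E, ‖x' - x‖ ≤ r₀ ∧ (∀ y ∈ F, |g y - f y| ≤ δ) ∧
        (∀ h ∈ G, h (T x' - T x) = 0) ∧ M * 2 ≤ g (T x' - T x)) (k : ℕ) :
    ∀ x ∈ S, ∀ f ∈ E, ∀ F : Finset Y, ∀ δ > 0, ∀ G : Finset (Y →L[ℝ] ℝ),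
      ∃ x' ∈ S, ∃ g ∈ E, ‖x' - x‖ ≤ r₀ * (2 * (1 - b)) ^ k ∧ (∀ y ∈ F, |g y - f y| ≤ δ) ∧
        (∀ h ∈ G, h (T x' - T x) = 0) ∧ M * (1 + 2 ^ k) ≤ g (T x' - T x) := by
  classical
  induction k with
  | zero =>
    intro x hx f hf F δ hδ G
    obtain ⟨x', h1, g, h2, h3, h4, h5, h6⟩ := h0 x hx f hf F δ hδ G
    refine ⟨x', h1, g, h2, by simpa using h3, h4, h5, ?_⟩
    rw [pow_zero]; linarith
  | succ k ih =>
    intro x hx f hf F δ hδ G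
    have hMp : 0 < M := by linarith
    set ρ := r₀ * (2 * (1 - b)) ^ k with hρ
    have hρp : 0 < ρ := by
      have : 0 < 2 * (1 - b) := by linarith
      positivity
    set δ' := min (δ / 2) M with hδ'
    have hδ'p : 0 < δ' := lt_min (by positivity) hMp
    obtain ⟨x₁, hx₁, f₁, hf₁, a1, a2, a3, a4⟩ := ih x hx f hf F δ' hδ'p G
    obtain ⟨p, hp, hpr⟩ := exists_seq_of_forall_finset_exists
      (fun p : X × (Y →L[ℝ] ℝ) => p.1 ∈ S ∧ p.2 ∈ E ∧ ‖p.1 - x₁‖ ≤ ρ ∧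
        (∀ y ∈ insert (T x₁ - T x) F, |p.2 y - f₁ y| ≤ δ') ∧ (∀ h ∈ G, h (T p.1 - T x₁) = 0) ∧
        M * (1 + 2 ^ k) ≤ p.2 (T p.1 - T x₁))
      (fun p q => p.2 (T q.1 - T x₁) = 0) (fun s _ => by
        obtain ⟨x₂, hx₂, f₂, hf₂, b1, b2, b3, b4⟩ := ih x₁ hx₁ f₁ hf₁ (insert (T x₁ - T x) F) δ' hδ'p
          (G ∪ s.image Prod.snd)
        refine ⟨(x₂, f₂), ⟨hx₂, hf₂, b1, b2, fun h hh => b3 h (Finset.mem_union_left _ hh), b4⟩,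
          fun q hq => b3 q.2 (Finset.mem_union_right _ (Finset.mem_image_of_mem _ hq))⟩)
    have hsep : ∀ i j, i < j → 1 / (L * r₀) * ρ ≤ ‖(p i).1 - (p j).1‖ := fun i j hij => by
      have e1 : (p i).2 (T (p i).1 - T (p j).1) =
          (p i).2 (T (p i).1 - T x₁) - (p i).2 (T (p j).1 - T x₁) := by
        rw [← map_sub, sub_sub_sub_cancel_right]
      rw [hpr i j hij, sub_zero] at e1
      obtain ⟨c1, c2, c3, c4, c5, c6⟩ := hp i
      have e2 : M * (1 + 2 ^ k) ≤ M * ‖T (p i).1 - T (p j).1‖ := by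
        calc _ ≤ (p i).2 (T (p i).1 - T (p j).1) := by rw [e1]; exact c6
          _ ≤ ‖(p i).2‖ * ‖T (p i).1 - T (p j).1‖ := (le_abs_self _).trans ((p i).2.le_opNorm _)
          _ ≤ _ := mul_le_mul_of_nonneg_right (hEM _ c2) (norm_nonneg _)
      have e3 : 1 + 2 ^ k ≤ ‖T (p i).1 - T (p j).1‖ := le_of_mul_le_mul_left e2 hMp
      have h2k : (0 : ℝ) < 2 ^ k := by positivity
      have e4 := hL _ c1 _ (hp j).1 (by linarith)
      have e5 : 1 / (L * r₀) * ρ = (2 ^ k * (1 - b) ^ k) / L := by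
        rw [hρ, mul_pow]; field_simp
      rw [e5, div_le_iff₀ (by linarith)]
      have e6 : (1 - b) ^ k ≤ 1 := pow_le_one₀ (by linarith) (by linarith [hb.1])
      nlinarith
    obtain ⟨n, hn⟩ := aux_beta hb x₁ x (fun n => (p n).1) ρ hρp (by rwa [norm_sub_rev])
      (fun n => (hp n).2.2.1) (fun i j hij => by
        rcases lt_or_gt_of_ne hij with h | h
        · exact hsep i j h
        · rw [norm_sub_rev]; exact hsep j i h)
    obtain ⟨c1, c2, c3, c4, c5, c6⟩ := hp n
    refine ⟨(p n).1, c1, (p n).2, c2, ?_, ?_, ?_, ?_⟩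
    · calc _ ≤ _ := hn
        _ = _ := by rw [hρ, pow_succ]; ring
    · intro y hy
      have g1 := c4 y (Finset.mem_insert_of_mem hy)
      have g2 := a2 y hy
      have g3 := abs_sub_le ((p n).2 y) (f₁ y) (f y)
      have g4 : δ' ≤ δ / 2 := min_le_left _ _
      linarith
    · intro h hh
      rw [← sub_add_sub_cancel (T (p n).1) (T x₁) (T x), map_add, c5 h hh, a3 h hh, add_zero]
    · rw [← sub_add_sub_cancel (T (p n).1) (T x₁) (T x), map_add]
      have g1 := c4 _ (Finset.mem_insert_self _ _)
      have g4 : δ' ≤ M := min_le_right _ _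
      have g5 := (abs_le.1 g1).1
      rw [pow_succ]
      linarith

lemma betaModSet_anti {X : Type*} [NormedAddCommGroup X] {t t' b b' : ℝ} (h : t ≤ t')
    (hb : b ∈ betaModSet X t) (hb' : b' ≤ b) (h0 : 0 ≤ b') : b' ∈ betaModSet X t' :=
  ⟨h0, fun x hx xs h1 h2 => by
    obtain ⟨n, hn⟩ := hb.2 x hx xs h1 (fun i j hij => h.trans (h2 i j hij))
    exact ⟨n, by linarith⟩⟩

lemma aux_sep {X Y : Type*} [NormedAddCommGroup X] [NormedSpace ℝ X]
    [NormedAddCommGroup Y] [NormedSpace ℝ Y] [TopologicalSpace.SeparableSpace Y]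
    (hβ : PropertyBeta X)
    (S : Set X) (T : X → Y) (hsurj : T '' S = Set.univ) (L c₀ : ℝ) (hL1 : 1 ≤ L)
    (hL : ∀ x ∈ S, ∀ x' ∈ S, 1 < ‖T x - T x'‖ → ‖T x - T x'‖ ≤ L * ‖x - x'‖)
    (hc₀ : 0 < c₀) (hc : CoL T S c₀ 1) :
    TopologicalSpace.SeparableSpace (Y →L[ℝ] ℝ) := by
  by_contra hns
  obtain ⟨M, hM, ε, hε, E, ⟨f, hf⟩, hEM, hE⟩ := aux_E hns
  have hE2 := aux_E2 hε hE
  set r₀ := max 1 (4 * M / ε / c₀) with hr₀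
  have hr1 : 1 ≤ r₀ := le_max_left _ _
  have hr0p : 0 < r₀ := by linarith
  have hr2 : 4 * M / ε ≤ c₀ * r₀ := by
    have : 4 * M / ε / c₀ ≤ r₀ := le_max_right _ _
    rw [div_le_iff₀ hc₀] at this; linarith
  obtain ⟨a, ha1, ha2, ha⟩ := hβ
  have hLr : 0 < L * r₀ := by positivity
  have hLr1 : 1 ≤ L * r₀ := by nlinarith
  obtain ⟨b₁, hb₁, hb₁'⟩ := ha (1 / (L * r₀)) (by positivity)
    (((div_le_one hLr).2 hLr1).trans ha1)
  set b := min b₁ (1 / 2) with hbd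
  have hbp : 0 < b := lt_min hb₁ (by norm_num)
  have hb1 : b < 1 := (min_le_right _ _).trans_lt (by norm_num)
  have hb : b ∈ betaModSet X (1 / (L * r₀)) :=
    betaModSet_anti le_rfl (⟨hb₁.le, hb₁'⟩ : b₁ ∈ betaModSet X _) (min_le_left _ _) hbp.le
  obtain ⟨x₀, hx₀, -⟩ : (0 : Y) ∈ T '' S := by rw [hsurj]; trivial
  have claim := aux_claim S T L r₀ M b hL1 hL hr0p hM hb hb1 E hEM (by
    intro x hx f hf F δ hδ G
    obtain ⟨g, hg, hgF, z, hz1, hz2, hz3⟩ := hE2 f hf F δ hδ G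
    obtain ⟨x', hx', h1, h2⟩ := hc r₀ hr1 x hx (T x + (4 * M / ε) • z) (by
      rw [add_sub_cancel_left, norm_smul, Real.norm_of_nonneg (by positivity)]
      refine le_trans ?_ hr2
      exact mul_le_of_le_one_right (by positivity) hz1)
    refine ⟨x', hx', g, hg, h1, hgF, fun h hh => ?_, ?_⟩
    · rw [h2, add_sub_cancel_left, map_smul, hz2 h hh, smul_zero]
    · rw [h2, add_sub_cancel_left, map_smul, smul_eq_mul]
      calc M * 2 = 4 * M / ε * (ε / 2) := by field_simp; norm_num
        _ ≤ _ := mul_le_mul_of_nonneg_left hz3 (by positivity))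
  obtain ⟨k, hk⟩ := exists_pow_lt_of_lt_one (show 0 < 1 / (L * r₀) by positivity)
    (show 1 - b < 1 by linarith)
  obtain ⟨x', hx', g, hg, h1, -, -, h2⟩ := claim k x₀ hx₀ f hf ∅ 1 one_pos ∅
  have hMp : 0 < M := by linarith
  have e2 : M * (1 + 2 ^ k) ≤ M * ‖T x' - T x₀‖ :=
    calc _ ≤ _ := h2
      _ ≤ ‖g‖ * ‖T x' - T x₀‖ := (le_abs_self _).trans (g.le_opNorm _)
      _ ≤ _ := mul_le_mul_of_nonneg_right (hEM _ hg) (norm_nonneg _)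
  have e3 : 1 + 2 ^ k ≤ ‖T x' - T x₀‖ := le_of_mul_le_mul_left e2 hMp
  have h2k : (0 : ℝ) < 2 ^ k := by positivity
  have e4 := hL _ hx' _ hx₀ (by linarith)
  rw [lt_div_iff₀ hLr] at hk
  have e5 : L * ‖x' - x₀‖ ≤ 2 ^ k * ((1 - b) ^ k * (L * r₀)) :=
    calc _ ≤ L * (r₀ * (2 * (1 - b)) ^ k) := mul_le_mul_of_nonneg_left h1 (by linarith)
      _ = _ := by rw [mul_pow]; ring
  nlinarith

lemma aux_weak {Y : Type*} [NormedAddCommGroup Y] [NormedSpace ℝ Y]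
    (hs : TopologicalSpace.SeparableSpace (Y →L[ℝ] ℝ)) (F : Set Y) (ρ ε : ℝ) (hε : 0 < ε)
    (hF : F ⊆ closedBall 0 ρ) (y : Y) (hy : y ∈ sigmaPrime ε F) :
    ∃ w : ℕ → Y, WeaklyNull w ∧ ∀ n, y + w n ∈ F ∧ ε / 2 ≤ ‖w n‖ := by
  set f : ℕ → (Y →L[ℝ] ℝ) := TopologicalSpace.denseSeq (Y →L[ℝ] ℝ) with hf
  have key : ∀ n : ℕ, ∃ p ∈ F, (∀ i : Fin (n + 1), |f i p - f i y| < 1 / ((n : ℝ) + 1)) ∧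
      ε / 2 ≤ ‖p - y‖ := by
    intro n
    by_contra hcon
    push Not at hcon
    set U : Set Y := {z | ∀ i : Fin (n + 1), |f i z - f i y| < 1 / ((n : ℝ) + 1)} with hU
    have hUo : WeaklyOpen U := by
      intro z hz
      obtain ⟨i₀, hi₀⟩ := Finite.exists_min
        (fun i : Fin (n + 1) => 1 / ((n : ℝ) + 1) - |f i z - f i y|)
      refine ⟨n + 1, fun i => f i, 1 / ((n : ℝ) + 1) - |f i₀ z - f i₀ y|,
        sub_pos.2 (hz i₀), fun z' hz' i => ?_⟩
      have h1 := hz' i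
      have h2 := hi₀ i
      have h3 := abs_sub_le (f i z') (f i z) (f i y)
      simp only at h1 h2
      linarith
    apply hy.2
    refine ⟨U ∩ F, ⟨⟨U, hUo, rfl⟩, ?_⟩, ?_, hy.1⟩
    · refine diam_le_of_forall_dist_le hε.le fun p hp q hq => ?_
      have h1 := hcon p hp.2 hp.1
      have h2 := hcon q hq.2 hq.1
      have h3 := dist_triangle_right p q y
      rw [dist_eq_norm p y, dist_eq_norm q y] at h3
      linarith
    · intro i
      rw [sub_self, abs_zero]; positivity
  choose p hpF hp1 hp2 using key
  refine ⟨fun n => p n - y, ?_, fun n => ⟨by simpa using hpF n, hp2 n⟩⟩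
  intro g
  have hρ : 0 ≤ ρ := by
    have := hF hy.1
    rw [mem_closedBall_zero_iff] at this
    exact (norm_nonneg _).trans this
  have hb : ∀ n, ‖p n - y‖ ≤ 2 * ρ := fun n => by
    have h1 := hF (hpF n)
    have h2 := hF hy.1
    rw [mem_closedBall_zero_iff] at h1 h2
    have := norm_sub_le (p n) y
    linarith
  rw [Metric.tendsto_atTop]
  intro η hη
  obtain ⟨k, hk⟩ := (TopologicalSpace.denseRange_denseSeq (Y →L[ℝ] ℝ)).exists_dist_lt g
    (show 0 < η / (2 * (2 * ρ + 1)) by positivity)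
  rw [dist_eq_norm, ← hf] at hk
  obtain ⟨m, hm⟩ := exists_nat_one_div_lt (show 0 < η / 2 by positivity)
  refine ⟨max k m, fun n hn => ?_⟩
  have hkn : k ≤ n := (le_max_left _ _).trans hn
  have hmn : m ≤ n := (le_max_right _ _).trans hn
  have h1 := hp1 n ⟨k, by omega⟩
  simp only at h1
  have h2 : 1 / ((n : ℝ) + 1) ≤ 1 / ((m : ℝ) + 1) := by
    apply one_div_le_one_div_of_le (by positivity)
    have : (m : ℝ) ≤ n := by exact_mod_cast hmn
    linarith
  have h3 : g (p n - y) = (g - f k) (p n - y) + (f k (p n) - f k y) := by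
    simp only [map_sub, ContinuousLinearMap.sub_apply]; ring
  have h4 : |(g - f k) (p n - y)| ≤ η / 2 :=
    calc _ ≤ ‖g - f k‖ * ‖p n - y‖ := (g - f k).le_opNorm _
      _ ≤ η / (2 * (2 * ρ + 1)) * (2 * ρ + 1) :=
        mul_le_mul hk.le (by linarith [hb n]) (norm_nonneg _) (by positivity)
      _ = η / 2 := by field_simp
  rw [dist_zero_right, Real.norm_eq_abs, h3]
  exact (abs_add_le _ _).trans_lt (by linarith)

lemma aux_subseq {Y : Type*} [NormedAddCommGroup Y] [NormedSpace ℝ Y] (w : ℕ → Y)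
    (hw : WeaklyNull w) (s : ℝ) (hs : 0 < s) (hn : ∀ n, 2 * s ≤ ‖w n‖) :
    ∃ σ : ℕ → ℕ, StrictMono σ ∧ ∀ i j, i ≠ j → s ≤ ‖w (σ i) - w (σ j)‖ := by
  have ev : ∀ m, ∀ᶠ n in atTop, m < n ∧ s ≤ ‖w m - w n‖ := by
    intro m
    obtain ⟨g, hg1, hg2⟩ := exists_dual_vector'' ℝ (w m)
    have h1 := hw g
    have h2 : ∀ᶠ n in atTop, g (w n) < s := h1.eventually_lt_const hs
    filter_upwards [h2, eventually_gt_atTop m] with n hn1 hn2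
    refine ⟨hn2, ?_⟩
    have h3 : g (w m - w n) ≤ ‖w m - w n‖ :=
      (le_abs_self _).trans ((g.le_opNorm _).trans (mul_le_of_le_one_left (norm_nonneg _) hg1))
    rw [map_sub, hg2] at h3
    have := hn m
    simp only [RCLike.ofReal_real_eq_id, id_eq] at h3
    linarith
  obtain ⟨σ, -, hσ⟩ := exists_seq_of_forall_finset_exists (fun _ : ℕ => True)
    (fun m n => m < n ∧ s ≤ ‖w m - w n‖) (fun A _ => by
      have : ∀ᶠ n in atTop, ∀ m ∈ A, m < n ∧ s ≤ ‖w m - w n‖ :=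
        (Filter.eventually_all_finset A).2 fun m _ => ev m
      obtain ⟨n, hn⟩ := this.exists
      exact ⟨n, trivial, hn⟩)
  refine ⟨σ, fun i j hij => (hσ i j hij).1, fun i j hij => ?_⟩
  rcases lt_or_gt_of_ne hij with h | h
  · exact (hσ i j h).2
  · rw [norm_sub_rev]; exact (hσ j i h).2

lemma aux_step {X Y : Type*} [NormedAddCommGroup X] [NormedSpace ℝ X]
    [NormedAddCommGroup Y] [NormedSpace ℝ Y] [Nontrivial Y]
    (S : Set X) (T : X → Y) (hsurj : T '' S = Set.univ) (L c₀ : ℝ) (hL1 : 1 ≤ L)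
    (hL : ∀ x ∈ S, ∀ x' ∈ S, 1 < ‖T x - T x'‖ → ‖T x - T x'‖ ≤ L * ‖x - x'‖)
    (hc₀ : 0 < c₀) (hc : CoL T S c₀ 1) (hM : PropertyM Y)
    (hsep : TopologicalSpace.SeparableSpace (Y →L[ℝ] ℝ))
    (t b ε ρ : ℝ) (hε : 0 < ε) (hb : b ∈ betaModSet X t) (hb1 : b ≤ 1)
    (ht : t ≤ c₀ * (ε / 4) / (8 * L)) (hρ : ρ ≤ 1)
    (F : Set Y) (hF : F ⊆ closedBall 0 ρ) :
    sigmaPrime ε F ⊆ closedBall 0 (ρ - 2 * b / 3) := by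
  intro y hy
  obtain ⟨w, hw, hwF⟩ := aux_weak hsep F ρ ε hε hF y hy
  have hyρ : ‖y‖ ≤ ρ := by simpa using hF hy.1
  have hywρ : ∀ n, ‖y + w n‖ ≤ ρ := fun n => by simpa using hF (hwF n).1
  have hwn : ∀ n, ‖w n‖ ≤ 2 := fun n => by
    have : w n = (y + w n) - y := by abel
    rw [this]
    have := norm_sub_le (y + w n) y
    linarith [hywρ n]
  have hbnd : ∀ v : Y, ‖v‖ = 1 → IsBoundedUnder (· ≤ ·) atTop (fun n => ‖v + w n‖) := fun v hv =>
    isBoundedUnder_of ⟨3, fun n => by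
      have := norm_add_le v (w n)
      linarith [hwn n]⟩
  have hcob : ∀ v : Y, IsCoboundedUnder (· ≤ ·) atTop (fun n => ‖v + w n‖) := fun v =>
    IsBoundedUnder.isCoboundedUnder_le (isBoundedUnder_of ⟨0, fun n => norm_nonneg _⟩)
  set φ := ρ + 1 - ‖y‖ with hφ
  obtain ⟨u, hu, huw⟩ : ∃ u : Y, ‖u‖ = 1 ∧ ∀ n, ‖u + w n‖ ≤ φ := by
    have gen : ∀ u : Y, ‖u‖ = 1 → y = ‖y‖ • u → ∀ n, ‖u + w n‖ ≤ φ := by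
      intro u hu hyu n
      have e : u + w n = (y + w n) + (1 - ‖y‖) • u := by
        rw [sub_smul, one_smul, ← hyu]; abel
      rw [e]
      have h1 := norm_add_le (y + w n) ((1 - ‖y‖) • u)
      rw [norm_smul, hu, Real.norm_of_nonneg (by linarith)] at h1
      linarith [hywρ n]
    by_cases hy0 : y = 0
    · obtain ⟨u, hu⟩ := exists_norm_eq Y (zero_le_one' ℝ)
      exact ⟨u, hu, gen u hu (by simp [hy0])⟩
    · have hyn : ‖y‖ ≠ 0 := norm_ne_zero_iff.2 hy0
      have h1 : ‖‖y‖⁻¹ • y‖ = 1 := by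
        rw [norm_smul, norm_inv, norm_norm, inv_mul_cancel₀ hyn]
      exact ⟨_, h1, gen _ h1 (by rw [smul_smul, mul_inv_cancel₀ hyn, one_smul])⟩
  have hall : ∀ v : Y, ‖v‖ = 1 → ∀ η > 0, ∀ᶠ n in atTop, ‖v + w n‖ ≤ φ + η := by
    intro v hv η hη
    have h1 : limsup (fun n => ‖u + w n‖) atTop ≤ φ :=
      limsup_le_of_le (hcob u) (Eventually.of_forall huw)
    rw [hM u v hu hv w hw] at h1
    have h2 : limsup (fun n => ‖v + w n‖) atTop < φ + η := by linarith
    exact (eventually_lt_of_limsup_lt h2 (hbnd v hv)).mono fun n hn => hn.le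
  obtain ⟨σ, hσ, hσs⟩ := aux_subseq w hw (ε / 4) (by positivity)
    (fun n => by linarith [(hwF n).2])
  have := aux_fork S T hsurj L c₀ hL1 hL hc₀ hc t b (ε / 4) φ (by positivity) hb hb1 ht
    (by linarith) (by linarith [norm_nonneg y]) (fun n => w (σ n))
    (fun v hv η hη => hσ.tendsto_atTop.eventually (hall v hv η hη)) hσs
  rw [mem_closedBall_zero_iff]
  by_contra hcon
  push Not at hcon
  have h1 : φ < 1 + 2 * b / 3 := by linarith
  have h2 : φ * (1 - 2 * b / 3) < (1 + 2 * b / 3) * (1 - 2 * b / 3) :=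
    mul_lt_mul_of_pos_right h1 (by linarith)
  nlinarith [sq_nonneg b]

/-- Corollary `g_cor`. -/
theorem stmt17 {X Y : Type*} [NormedAddCommGroup X] [NormedSpace ℝ X] [CompleteSpace X]
    [NormedAddCommGroup Y] [NormedSpace ℝ Y] [CompleteSpace Y]
    [TopologicalSpace.SeparableSpace Y]
    (hX : ¬ FiniteDimensional ℝ X) (hY : ¬ FiniteDimensional ℝ Y)
    (hβ : PropertyBeta X) (hM : PropertyM Y)
    (S : Set X) (T : X → Y) (hsurj : T '' S = Set.univ)
    (hT : UniformQuotientOn T S) (hLip : LipschitzLargeDist T S) :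
    ∃ K : ℝ, 1 ≤ K ∧ ∀ ε : ℝ, 0 < ε → ε < 1 →
      ∃ n : ℕ, (n : ℝ) ≤ K * (betaMod X (ε / K))⁻¹ ∧
        (sigmaPrime ε)^[n] (closedBall (0 : Y) 1) = ∅ := by
  have hnt : Nontrivial Y := by
    by_contra hn
    rw [not_nontrivial_iff_subsingleton] at hn
    exact hY inferInstance
  obtain ⟨L, hL1, hL⟩ := aux_lip S T hT hLip
  obtain ⟨c₀, hc₀, hc⟩ := aux_colip S T hT
  have hsep := aux_sep hβ S T hsurj L c₀ hL1 hL hc₀ hc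
  have hLp : 0 < L := by linarith
  refine ⟨max 5 (32 * L / c₀), le_max_of_le_left (by norm_num), fun ε hε hε1 => ?_⟩
  set K := max 5 (32 * L / c₀) with hK
  have hK5 : 5 ≤ K := le_max_left _ _
  have hKp : 0 < K := by linarith
  have hKL : 32 * L / c₀ ≤ K := le_max_right _ _
  have ht : ε / K ≤ c₀ * (ε / 4) / (8 * L) := by
    rw [div_le_iff₀ hc₀] at hKL
    rw [div_le_div_iff₀ hKp (by positivity)]
    nlinarith
  have ht1 : ε / K ≤ 1 / 3 := by
    rw [div_le_div_iff₀ hKp (by norm_num)]; linarith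
  have hbd : ∀ b ∈ betaModSet X (ε / K), b ≤ 1 := by
    intro b hb
    obtain ⟨f, hf1, hf2⟩ := exists_seq_norm_le_one_le_norm_sub' (𝕜 := ℝ) (E := X) (c := 2)
      (R := 3) (by norm_num) (by norm_num) hX
    obtain ⟨n, hn⟩ := aux_beta hb (0 : X) 0 f 3 (by norm_num) (by simp) (fun n => by simpa using hf1 n)
      (fun i j hij => by have := hf2 hij; linarith)
    have := norm_nonneg (f n - 0)
    linarith
  have hBA : BddAbove (betaModSet X (ε / K)) := ⟨1, hbd⟩
  obtain ⟨a, ha1, -, ha⟩ := hβ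
  obtain ⟨b₀, hb₀, hb₀'⟩ := ha (ε / K) (by positivity) (by linarith)
  have hb₀m : b₀ ∈ betaModSet X (ε / K) := ⟨hb₀.le, hb₀'⟩
  have hpos : 0 < betaMod X (ε / K) := hb₀.trans_le (le_csSup hBA hb₀m)
  obtain ⟨b, hb, hbhalf⟩ := exists_lt_of_lt_csSup ⟨_, hb₀m⟩ (half_lt_self hpos)
  change betaMod X (ε / K) / 2 < b at hbhalf
  have hbp : 0 < b := by linarith
  have hb1 := hbd b hb
  have hstep : ∀ n : ℕ, (sigmaPrime ε)^[n] (closedBall (0 : Y) 1) ⊆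
      closedBall 0 (1 - n * (2 * b / 3)) := by
    intro n
    induction n with
    | zero => simp
    | succ n ih =>
      rw [Function.iterate_succ_apply']
      refine (aux_step S T hsurj L c₀ hL1 hL hc₀ hc hM hsep (ε / K) b ε _ hε hb hb1 ht ?_ _ ih).trans
        (closedBall_subset_closedBall ?_)
      · have : 0 ≤ (n : ℝ) * (2 * b / 3) := by positivity
        linarith
      · push_cast; linarith
  refine ⟨⌊3 / (2 * b)⌋₊ + 1, ?_, ?_⟩
  · have h1 : (⌊3 / (2 * b)⌋₊ : ℝ) ≤ 3 / (2 * b) := Nat.floor_le (by positivity)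
    have h2 : 3 / (2 * b) + 1 ≤ 5 / (2 * b) := by
      rw [div_add_one (by positivity)]
      exact div_le_div_of_nonneg_right (by linarith) (by positivity)
    have h3 : 5 / (2 * b) ≤ K * (betaMod X (ε / K))⁻¹ := by
      rw [← div_eq_mul_inv]
      exact div_le_div₀ hKp.le hK5 hpos (by linarith)
    push_cast
    linarith
  · rw [← subset_empty_iff]
    refine (hstep _).trans ?_
    rw [closedBall_eq_empty.2]
    have h1 := Nat.lt_floor_add_one (3 / (2 * b))
    rw [div_lt_iff₀ (by positivity)] at h1
    push_cast
    linarith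

end
end

section
/- Let 1 < p < ∞ and let X = (∑_{k=1}^∞ E_k)_{ℓ_p}, where (E_k) is a sequence of nonzero finite-dimensional normed spaces. Then for every t > 0, δ̄_X(t) = ρ̄_X(t) = (1 + t^p)^{1/p} − 1; in particular X is both asymptotically uniformly convex and asymptotically uniformly smooth. -/
open Set Metric Filter Topology

noncomputable section

lemma aux_bdd_above {Y : Type*} [NormedAddCommGroup Y] [NormedSpace ℝ Y] (t : ℝ) (ht : 0 < t)
    (y : Y) (Z : Subspace ℝ Y) :
    BddAbove {r | ∃ z ∈ Z, ‖z‖ = 1 ∧ r = ‖y + t • z‖ - 1} := by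
  refine ⟨‖y‖ + t, ?_⟩
  rintro r ⟨z, _, hz, rfl⟩
  have := norm_add_le y (t • z)
  rw [norm_smul, hz, Real.norm_eq_abs, abs_of_pos ht] at this
  linarith

lemma aux_bdd_below {Y : Type*} [NormedAddCommGroup Y] [NormedSpace ℝ Y] (t : ℝ)
    (y : Y) (Z : Subspace ℝ Y) :
    BddBelow {r | ∃ z ∈ Z, ‖z‖ = 1 ∧ r = ‖y + t • z‖ - 1} := by
  refine ⟨-1, ?_⟩
  rintro r ⟨z, _, hz, rfl⟩
  have := norm_nonneg (y + t • z)
  linarith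

lemma aux_inter {Y : Type*} [NormedAddCommGroup Y] [NormedSpace ℝ Y]
    (hY : ¬ FiniteDimensional ℝ Y) (Z W : Subspace ℝ Y) (hZ : FinCodim Z) (hW : FinCodim W) :
    ∃ z, z ∈ Z ∧ z ∈ W ∧ ‖z‖ = 1 := by
  by_contra! h
  apply hY
  have := hZ.2
  have := hW.2
  refine FiniteDimensional.of_injective (LinearMap.prod Z.mkQ W.mkQ) ?_
  rw [← LinearMap.ker_eq_bot, LinearMap.ker_prod, Submodule.ker_mkQ, Submodule.ker_mkQ, eq_bot_iff]
  rintro x ⟨hx1, hx2⟩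
  by_contra hx
  have hx0 : x ≠ 0 := hx
  refine h (‖x‖⁻¹ • x) (Z.smul_mem _ hx1) (W.smul_mem _ hx2) ?_
  rw [norm_smul, norm_inv, norm_norm]
  exact inv_mul_cancel₀ (norm_ne_zero_iff.2 hx0)

lemma aux_rho {Y : Type*} [NormedAddCommGroup Y] [NormedSpace ℝ Y]
    (hY : ¬ FiniteDimensional ℝ Y) (t : ℝ) (ht : 0 < t) (y : Y) (c : ℝ)
    (h : ∀ ε > 0, ∃ W : Subspace ℝ Y, FinCodim W ∧ ∀ z ∈ W, ‖z‖ = 1 → |‖y + t • z‖ - c| ≤ ε) :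
    rhoAt t y = c - 1 ∧ deltaAt t y = c - 1 := by
  have hlow : ∀ Z : Subspace ℝ Y, FinCodim Z →
      c - 1 ≤ sSup {r | ∃ z ∈ Z, ‖z‖ = 1 ∧ r = ‖y + t • z‖ - 1} := by
    intro Z hZ
    refine le_of_forall_pos_le_add fun ε hε => ?_
    obtain ⟨W, hW, hW'⟩ := h ε hε
    obtain ⟨z, hz1, hz2, hz⟩ := aux_inter hY Z W hZ hW
    have h1 := le_csSup (aux_bdd_above t ht y Z) ⟨z, hz1, hz, rfl⟩
    have h2 := (abs_le.1 (hW' z hz2 hz)).1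
    linarith
  have hup : ∀ Z : Subspace ℝ Y, FinCodim Z →
      sInf {r | ∃ z ∈ Z, ‖z‖ = 1 ∧ r = ‖y + t • z‖ - 1} ≤ c - 1 := by
    intro Z hZ
    refine le_of_forall_pos_le_add fun ε hε => ?_
    obtain ⟨W, hW, hW'⟩ := h ε hε
    obtain ⟨z, hz1, hz2, hz⟩ := aux_inter hY Z W hZ hW
    have h1 := csInf_le (aux_bdd_below t y Z) ⟨z, hz1, hz, rfl⟩
    have h2 := (abs_le.1 (hW' z hz2 hz)).2
    linarith
  constructor
  · apply le_antisymm
    · refine le_of_forall_pos_le_add fun ε hε => ?_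
      obtain ⟨W, hW, hW'⟩ := h ε hε
      obtain ⟨z, hz1, hz2, hz⟩ := aux_inter hY W W hW hW
      refine le_trans (csInf_le ⟨c - 1, ?_⟩ ⟨W, hW, rfl⟩) ?_
      · rintro s ⟨Z, hZ, rfl⟩
        exact hlow Z hZ
      · refine csSup_le ⟨_, z, hz1, hz, rfl⟩ ?_
        rintro r ⟨z, hz1, hz, rfl⟩
        have h2 := (abs_le.1 (hW' z hz1 hz)).2
        linarith
    · obtain ⟨W, hW, hW'⟩ := h 1 one_pos
      refine le_csInf ⟨_, W, hW, rfl⟩ ?_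
      rintro s ⟨Z, hZ, rfl⟩
      exact hlow Z hZ
  · apply le_antisymm
    · obtain ⟨W, hW, hW'⟩ := h 1 one_pos
      refine csSup_le ⟨_, W, hW, rfl⟩ ?_
      rintro s ⟨Z, hZ, rfl⟩
      exact hup Z hZ
    · refine le_of_forall_pos_le_add fun ε hε => ?_
      obtain ⟨W, hW, hW'⟩ := h ε hε
      obtain ⟨z, hz1, hz2, hz⟩ := aux_inter hY W W hW hW
      rw [← sub_le_iff_le_add]
      refine le_trans ?_ (le_csSup ⟨c - 1, ?_⟩ ⟨W, hW, rfl⟩)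
      · refine le_csInf ⟨_, z, hz1, hz, rfl⟩ ?_
        rintro r ⟨z, hz1, hz, rfl⟩
        have h2 := (abs_le.1 (hW' z hz1 hz)).1
        linarith
      · rintro s ⟨Z, hZ, rfl⟩
        exact hup Z hZ

lemma aux_mod {Y : Type*} [NormedAddCommGroup Y] [NormedSpace ℝ Y]
    (hY : ¬ FiniteDimensional ℝ Y) (t : ℝ) (ht : 0 < t) (c : ℝ)
    (h : ∀ y : Y, ‖y‖ = 1 → ∀ ε > 0, ∃ W : Subspace ℝ Y, FinCodim W ∧
      ∀ z ∈ W, ‖z‖ = 1 → |‖y + t • z‖ - c| ≤ ε) :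
    deltaMod Y t = c - 1 ∧ rhoMod Y t = c - 1 := by
  have hT : FinCodim (⊤ : Subspace ℝ Y) := ⟨isClosed_univ, inferInstance⟩
  obtain ⟨y, -, -, hy⟩ := aux_inter hY ⊤ ⊤ hT hT
  constructor
  · have : {r | ∃ y : Y, ‖y‖ = 1 ∧ r = deltaAt t y} = {c - 1} := by
      ext r
      constructor
      · rintro ⟨y, hy, rfl⟩
        exact (aux_rho hY t ht y c (h y hy)).2
      · rintro rfl
        exact ⟨y, hy, (aux_rho hY t ht y c (h y hy)).2.symm⟩
    rw [deltaMod, this, csInf_singleton]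
  · have : {r | ∃ y : Y, ‖y‖ = 1 ∧ r = rhoAt t y} = {c - 1} := by
      ext r
      constructor
      · rintro ⟨y, hy, rfl⟩
        exact (aux_rho hY t ht y c (h y hy)).1
      · rintro rfl
        exact ⟨y, hy, (aux_rho hY t ht y c (h y hy)).1.symm⟩
    rw [rhoMod, this, csSup_singleton]

lemma aux_infdim (q : ENNReal) [Fact (1 ≤ q)]
    (E : ℕ → Type*) [∀ k, NormedAddCommGroup (E k)] [∀ k, NormedSpace ℝ (E k)]
    [∀ k, Nontrivial (E k)] : ¬ FiniteDimensional ℝ (lp E q) := by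
  intro hf
  choose e he using fun k => exists_ne (0 : E k)
  have hli : LinearIndependent ℝ (fun k => (lp.single q k (e k) : lp E q)) := by
    rw [linearIndependent_iff']
    intro s g hg i hi
    have h1 := congrArg (fun f : lp E q => f i) hg
    simp only [lp.coeFn_sum, lp.coeFn_smul, Finset.sum_apply, Pi.smul_apply, lp.coeFn_zero,
      Pi.zero_apply] at h1
    rw [Finset.sum_eq_single i] at h1
    · rw [lp.single_apply_self] at h1
      exact (smul_eq_zero.1 h1).resolve_right (he i)
    · intro j _ hj
      rw [lp.single_apply_ne _ _ _ hj.symm, smul_zero]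
    · exact fun h => absurd hi h
  exact Module.Finite.not_linearIndependent_of_infinite _ hli

lemma aux_codim (q : ENNReal) [Fact (1 ≤ q)]
    (E : ℕ → Type*) [∀ k, NormedAddCommGroup (E k)] [∀ k, NormedSpace ℝ (E k)]
    [∀ k, FiniteDimensional ℝ (E k)] (s : Finset ℕ) :
    ∃ W : Subspace ℝ (lp E q), FinCodim W ∧ ∀ z ∈ W, ∀ i ∈ s, z i = 0 := by
  let L : lp E q →ₗ[ℝ] (∀ i : s, E i) :=
    { toFun := fun z i => z i
      map_add' := fun _ _ => rfl
      map_smul' := fun _ _ => rfl }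
  have hL : Continuous L := continuous_pi fun i => (lp.lipschitzWith_one_eval q (i : ℕ)).continuous
  refine ⟨LinearMap.ker L, ⟨?_, ?_⟩, ?_⟩
  · exact isClosed_singleton.preimage hL
  · exact FiniteDimensional.of_injective L.quotKerEquivRange.toLinearMap
      L.quotKerEquivRange.injective
  · intro z hz i hi
    exact congrFun (LinearMap.mem_ker.1 hz) ⟨i, hi⟩

lemma aux_norm (q : ENNReal) [Fact (1 ≤ q)] (hq : 0 < q.toReal)
    (E : ℕ → Type*) [∀ k, NormedAddCommGroup (E k)] [∀ k, NormedSpace ℝ (E k)]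
    (x z : lp E q) (h : ∀ i, x i = 0 ∨ z i = 0) :
    ‖x + z‖ ^ q.toReal = ‖x‖ ^ q.toReal + ‖z‖ ^ q.toReal := by
  refine (lp.hasSum_norm hq (x + z)).unique ?_
  convert (lp.hasSum_norm hq x).add (lp.hasSum_norm hq z) using 2 with i
  rw [lp.coeFn_add, Pi.add_apply]
  rcases h i with h | h <;> simp [h, Real.zero_rpow hq.ne']

lemma aux_key (p : ℝ) (hp : 1 < p) [Fact (1 ≤ ENNReal.ofReal p)]
    (E : ℕ → Type*) [∀ k, NormedAddCommGroup (E k)] [∀ k, NormedSpace ℝ (E k)]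
    [∀ k, FiniteDimensional ℝ (E k)] (t : ℝ) (ht : 0 < t)
    (y : lp E (ENNReal.ofReal p)) (hy : ‖y‖ = 1) (ε : ℝ) (hε : 0 < ε) :
    ∃ W : Subspace ℝ (lp E (ENNReal.ofReal p)), FinCodim W ∧
      ∀ z ∈ W, ‖z‖ = 1 → |‖y + t • z‖ - (1 + t ^ p) ^ (1 / p)| ≤ ε := by
  have hp0 : 0 < p := by linarith
  have hpr : (ENNReal.ofReal p).toReal = p := ENNReal.toReal_ofReal hp0.le
  have hS : Tendsto (fun s : Finset ℕ => ∑ i ∈ s, (lp.single (ENNReal.ofReal p) i (y i) : lp E _))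
      atTop (𝓝 y) := lp.hasSum_single ENNReal.ofReal_ne_top y
  have h1 : Tendsto (fun s : Finset ℕ =>
      (‖∑ i ∈ s, (lp.single (ENNReal.ofReal p) i (y i) : lp E _)‖ ^ p + t ^ p) ^ (1 / p))
      atTop (𝓝 ((1 + t ^ p) ^ (1 / p))) := by
    have := ((hS.norm.rpow_const (p := p) (Or.inr hp0.le)).add_const (t ^ p)).rpow_const
      (p := 1 / p) (Or.inr (by positivity))
    rwa [hy, Real.one_rpow] at this
  obtain ⟨s, hs1, hs2⟩ := ((Metric.tendsto_nhds.1 h1 (ε / 2) (by linarith)).and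
    (Metric.tendsto_nhds.1 hS (ε / 2) (by linarith))).exists
  obtain ⟨W, hW, hW'⟩ := aux_codim (ENNReal.ofReal p) E s
  refine ⟨W, hW, fun z hz hz1 => ?_⟩
  set x := ∑ i ∈ s, (lp.single (ENNReal.ofReal p) i (y i) : lp E _) with hx
  have hn := aux_norm (ENNReal.ofReal p) (by rw [hpr]; exact hp0) E x (t • z) (by
    intro i
    by_cases hi : i ∈ s
    · right
      rw [lp.coeFn_smul, Pi.smul_apply, hW' z hz i hi, smul_zero]
    · left
      rw [hx, lp.coeFn_sum, Finset.sum_apply]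
      refine Finset.sum_eq_zero fun j hj => ?_
      exact lp.single_apply_ne _ _ _ (fun h => hi (h ▸ hj)))
  rw [hpr, norm_smul, hz1, mul_one, Real.norm_eq_abs, abs_of_pos ht] at hn
  rw [← hn, ← Real.rpow_mul (norm_nonneg _), mul_one_div_cancel hp0.ne', Real.rpow_one,
    Real.dist_eq] at hs1
  rw [dist_eq_norm] at hs2
  have h3 : |‖y + t • z‖ - ‖x + t • z‖| ≤ ‖x - y‖ := by
    refine (abs_norm_sub_norm_le _ _).trans ?_
    rw [add_sub_add_right_eq_sub, norm_sub_rev]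
  have h4 := abs_sub_le ‖y + t • z‖ ‖x + t • z‖ ((1 + t ^ p) ^ (1 / p))
  linarith

lemma aux_lim (p : ℝ) (hp : 1 < p) :
    Tendsto (fun t : ℝ => ((1 + t ^ p) ^ (1 / p) - 1) / t) (𝓝[>] 0) (𝓝 0) := by
  have hp0 : p ≠ 0 := by linarith
  have h1 := ((Real.hasDerivAt_rpow_const (x := 0) (p := p) (Or.inr hp.le)).const_add 1).rpow_const
    (p := 1 / p) (Or.inl (by simp [Real.zero_rpow hp0]))
  rw [Real.zero_rpow (by linarith : p - 1 ≠ 0)] at h1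
  have h2 := h1.tendsto_slope_zero_right
  simp only [zero_add, Real.zero_rpow hp0, add_zero, Real.one_rpow, mul_zero, zero_mul,
    smul_eq_mul] at h2
  refine h2.congr fun t => ?_
  exact (div_eq_inv_mul _ _).symm

/-- for an `ℓ_p`-sum of finite-dimensional spaces (`1 < p < ∞`),
`δ̄_X(t) = ρ̄_X(t) = (1 + t^p)^{1/p} - 1`; in particular `X` is AUC and AUS. -/
theorem stmt18 (p : ℝ) (hp : 1 < p) [Fact (1 ≤ ENNReal.ofReal p)]
    (E : ℕ → Type*) [∀ k, NormedAddCommGroup (E k)] [∀ k, NormedSpace ℝ (E k)]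
    [∀ k, FiniteDimensional ℝ (E k)] [∀ k, Nontrivial (E k)] :
    (∀ t : ℝ, 0 < t →
        deltaMod (lp E (ENNReal.ofReal p)) t = (1 + t ^ p) ^ (1 / p) - 1 ∧
        rhoMod (lp E (ENNReal.ofReal p)) t = (1 + t ^ p) ^ (1 / p) - 1) ∧
      AUC (lp E (ENNReal.ofReal p)) ∧ AUS (lp E (ENNReal.ofReal p)) := by
  have H : ∀ t : ℝ, 0 < t →
        deltaMod (lp E (ENNReal.ofReal p)) t = (1 + t ^ p) ^ (1 / p) - 1 ∧
        rhoMod (lp E (ENNReal.ofReal p)) t = (1 + t ^ p) ^ (1 / p) - 1 := fun t ht =>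
    aux_mod (aux_infdim _ E) t ht _ fun y hy ε hε => aux_key p hp E t ht y hy ε hε
  refine ⟨H, ?_, ?_⟩
  · intro t ht
    rw [(H t ht).1, sub_pos]
    have : 0 < t ^ p := Real.rpow_pos_of_pos ht p
    exact Real.one_lt_rpow (by linarith) (by positivity)
  · refine (aux_lim p hp).congr' ?_
    filter_upwards [self_mem_nhdsWithin] with t ht
    rw [(H t ht).2]

end
end
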